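/- Let D = ker α∧β be an Engel structure such that dα ∧ dα = 0, dβ ∧ dβ = 0, and dα ∧ β = 0. Suppose there exists a section X of D transverse to the characteristic foliation W such that L_R⟨X⟩ = ⟨X⟩ (the flow of the Reeb vector field R preserves the line field spanned by X). Then there exists a Riemannian metric g such that (D, g, R) is a K-Engel structure. -/

import Mathlib

noncomputable section

open Manifold Module Function Set

variable {E : Type*} [NormedAddCommGroup E] [NormedSpace ℝ E]
  {H : Type*} [TopologicalSpace H]

/-- The type of (not necessarily smooth) vector fields on a manifold. -/
abbrev VF (I : ModelWithCorners ℝ E H) (M : Type*) [TopologicalSpace M] [ChartedSpace H M] :=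
  ∀ x : M, TangentSpace I x

/-- A vector field is smooth if the corresponding section of the tangent bundle is smooth. -/
def SmoothVF (I : ModelWithCorners ℝ E H) {M : Type*} [TopologicalSpace M] [ChartedSpace H M]
    [IsManifold I (⊤ : ℕ∞) M] (V : VF I M) : Prop :=
  ContMDiff I I.tangent (⊤ : ℕ∞) (fun x => (⟨x, V x⟩ : TangentBundle I M))

/-- A smooth real valued function on a manifold. -/
def SmoothFn (I : ModelWithCorners ℝ E H) {M : Type*} [TopologicalSpace M] [ChartedSpace H M]
    [IsManifold I (⊤ : ℕ∞) M] (f : M → ℝ) : Prop :=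
  ContMDiff I 𝓘(ℝ) (⊤ : ℕ∞) f

/-- Derivative of a real valued function along a vector field. -/
def vderiv (I : ModelWithCorners ℝ E H) {M : Type*} [TopologicalSpace M] [ChartedSpace H M]
    [IsManifold I (⊤ : ℕ∞) M] (V : VF I M) (f : M → ℝ) : M → ℝ :=
  fun x => mfderiv I 𝓘(ℝ) f x (V x)

/-- The Lie bracket of two vector fields on a manifold, defined by transporting the two
vector fields to the model space via the preferred chart at the given point, taking the
Lie bracket of vector fields there, and transporting the result back.  For smooth vector
fields this is the usual Lie bracket `[V, W]`. -/
def vfLie (I : ModelWithCorners ℝ E H) {M : Type*} [TopologicalSpace M] [ChartedSpace H M]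
    [IsManifold I (⊤ : ℕ∞) M] (V W : VF I M) : VF I M := fun x₀ =>
  mfderiv 𝓘(ℝ, E) I (extChartAt I x₀).symm (extChartAt I x₀ x₀)
    ((VectorField.lieBracket ℝ
      (fun e => (mfderiv I 𝓘(ℝ, E) (extChartAt I x₀) ((extChartAt I x₀).symm e)
        (V ((extChartAt I x₀).symm e)) : E))
      (fun e => (mfderiv I 𝓘(ℝ, E) (extChartAt I x₀) ((extChartAt I x₀).symm e)
        (W ((extChartAt I x₀).symm e)) : E))
      (extChartAt I x₀ x₀) : E))

/-- A smooth differential `1`-form on a manifold, given by its pointwise values. -/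
structure OneForm (I : ModelWithCorners ℝ E H) (M : Type*) [TopologicalSpace M]
    [ChartedSpace H M] [IsManifold I (⊤ : ℕ∞) M] where
  val : ∀ x : M, TangentSpace I x →ₗ[ℝ] ℝ
  smooth' : ∀ V : VF I M, SmoothVF I V → SmoothFn I (fun x => val x (V x))

/-- A smooth differential `k`-form on a manifold, given by its pointwise values. -/
structure FormPt (I : ModelWithCorners ℝ E H) (M : Type*) [TopologicalSpace M]
    [ChartedSpace H M] [IsManifold I (⊤ : ℕ∞) M] (k : ℕ) where
  val : ∀ x : M, (TangentSpace I x) [⋀^Fin k]→ₗ[ℝ] ℝ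
  smooth' : ∀ V : Fin k → VF I M, (∀ i, SmoothVF I (V i)) →
    SmoothFn I (fun x => val x (fun i => V i x))

variable {I : ModelWithCorners ℝ E H} {M : Type*} [TopologicalSpace M] [ChartedSpace H M]
  [IsManifold I (⊤ : ℕ∞) M]

/-- The exterior derivative of a (pointwise defined) `1`-form, evaluated on two vector
fields, via the Cartan formula `dω(V,W) = V (ω W) - W (ω V) - ω [V,W]`.  Here the `1`-form
is given as a function on vector fields. -/
def dOfFun (I : ModelWithCorners ℝ E H) {M : Type*} [TopologicalSpace M] [ChartedSpace H M]
    [IsManifold I (⊤ : ℕ∞) M] (lam : VF I M → M → ℝ) (V W : VF I M) : M → ℝ :=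
  fun x => vderiv I V (lam W) x - vderiv I W (lam V) x - lam (vfLie I V W) x

/-- The exterior derivative of a `1`-form, as a function of two vector fields. -/
def OneForm.d (ω : OneForm I M) (V W : VF I M) : M → ℝ :=
  dOfFun I (fun U x => ω.val x (U x)) V W

/-- A distribution (field of tangent subspaces) on a manifold. -/
abbrev TangentDist (I : ModelWithCorners ℝ E H) (M : Type*) [TopologicalSpace M] [ChartedSpace H M] :=
  ∀ x : M, Submodule ℝ (TangentSpace I x)

/-- A (smooth) section of a distribution. -/
def IsSection (I : ModelWithCorners ℝ E H) {M : Type*} [TopologicalSpace M] [ChartedSpace H M]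
    [IsManifold I (⊤ : ℕ∞) M] (D : TangentDist I M) (V : VF I M) : Prop :=
  SmoothVF I V ∧ ∀ x, V x ∈ D x

/-- The distribution `[D, D]` generated by a distribution `D` together with all Lie brackets
of its sections. -/
def derivedDist (I : ModelWithCorners ℝ E H) {M : Type*} [TopologicalSpace M] [ChartedSpace H M]
    [IsManifold I (⊤ : ℕ∞) M] (D : TangentDist I M) : TangentDist I M := fun x =>
  Submodule.span ℝ
    ({v | ∃ V, IsSection I D V ∧ V x = v} ∪
     {v | ∃ V W, IsSection I D V ∧ IsSection I D W ∧ vfLie I V W x = v})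

/-- A distribution is integrable (in the sense of Frobenius: involutive) if Lie brackets of
its sections are again tangent to it. -/
def IsIntegrableDist (I : ModelWithCorners ℝ E H) {M : Type*} [TopologicalSpace M]
    [ChartedSpace H M] [IsManifold I (⊤ : ℕ∞) M] (D : TangentDist I M) : Prop :=
  ∀ V W, IsSection I D V → IsSection I D W → ∀ x, vfLie I V W x ∈ D x

/-- `(ω ∧ θ)(U,V,W)` for a `1`-form `ω` and a `2`-form `θ` given as a function of two
vector fields. -/
def wedge1_2 (I : ModelWithCorners ℝ E H) {M : Type*} [TopologicalSpace M] [ChartedSpace H M]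
    [IsManifold I (⊤ : ℕ∞) M] (ω : OneForm I M) (θ : VF I M → VF I M → M → ℝ)
    (U V W : VF I M) : M → ℝ := fun x =>
  ω.val x (U x) * θ V W x - ω.val x (V x) * θ U W x + ω.val x (W x) * θ U V x

/-- The square `θ ∧ θ` of a `2`-form `θ` (given as a function of two vector fields) vanishes
identically. -/
def FormSqZero (I : ModelWithCorners ℝ E H) {M : Type*} [TopologicalSpace M] [ChartedSpace H M]
    [IsManifold I (⊤ : ℕ∞) M] (θ : VF I M → VF I M → M → ℝ) : Prop :=
  ∀ V₀ V₁ V₂ V₃ : VF I M, SmoothVF I V₀ → SmoothVF I V₁ → SmoothVF I V₂ → SmoothVF I V₃ →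
    ∀ x, θ V₀ V₁ x * θ V₂ V₃ x - θ V₀ V₂ x * θ V₁ V₃ x + θ V₀ V₃ x * θ V₁ V₂ x = 0

/-- An Engel structure: a rank 2 distribution `D` such that `E := [D,D]` has rank 3 and
`[E,E] = TM`. -/
def IsEngel (I : ModelWithCorners ℝ E H) {M : Type*} [TopologicalSpace M] [ChartedSpace H M]
    [IsManifold I (⊤ : ℕ∞) M] (D : TangentDist I M) : Prop :=
  (∀ x, Module.finrank ℝ (D x) = 2) ∧ (∀ x, Module.finrank ℝ (derivedDist I D x) = 3) ∧
  (∀ x, derivedDist I (derivedDist I D) x = ⊤)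

/-- Engel defining forms: `D = ker α ∩ ker β` and `E = [D,D] = ker α`. -/
def EngelDefiningForms (I : ModelWithCorners ℝ E H) {M : Type*} [TopologicalSpace M]
    [ChartedSpace H M] [IsManifold I (⊤ : ℕ∞) M] (D : TangentDist I M)
    (α β : OneForm I M) : Prop :=
  (∀ x, D x = LinearMap.ker (α.val x) ⊓ LinearMap.ker (β.val x)) ∧
  (∀ x, derivedDist I D x = LinearMap.ker (α.val x))

/-- The pair of Reeb vector fields `T`, `R` associated with Engel defining forms `α`, `β`:
`i_T(α ∧ dβ) = 0`, `β(T) = 1`, `α(T) = 0`, `i_R(β ∧ dβ) = 0`, `β(R) = 0`, `α(R) = 1`. -/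
structure IsReebPair (I : ModelWithCorners ℝ E H) {M : Type*} [TopologicalSpace M]
    [ChartedSpace H M] [IsManifold I (⊤ : ℕ∞) M] (α β : OneForm I M)
    (T R : VF I M) : Prop where
  smoothT : SmoothVF I T
  smoothR : SmoothVF I R
  alphaT : ∀ x, α.val x (T x) = 0
  betaT : ∀ x, β.val x (T x) = 1
  alphaR : ∀ x, α.val x (R x) = 1
  betaR : ∀ x, β.val x (R x) = 0
  insT : ∀ V W, SmoothVF I V → SmoothVF I W → ∀ x, wedge1_2 I α β.d T V W x = 0
  insR : ∀ V W, SmoothVF I V → SmoothVF I W → ∀ x, wedge1_2 I β β.d R V W x = 0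

/-- The Reeb distribution spanned by the two Reeb vector fields. -/
def reebDist (I : ModelWithCorners ℝ E H) {M : Type*} [TopologicalSpace M] [ChartedSpace H M]
    (T R : VF I M) : TangentDist I M := fun x => Submodule.span ℝ {T x, R x}

/-- `W` is a nonsingular vector field spanning the characteristic foliation of the even
contact structure `E = [D,D]`:  `W` is tangent to `D` and `[W, E] ⊆ E`. -/
def SpansChar (I : ModelWithCorners ℝ E H) {M : Type*} [TopologicalSpace M] [ChartedSpace H M]
    [IsManifold I (⊤ : ℕ∞) M] (D : TangentDist I M) (W : VF I M) : Prop :=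
  SmoothVF I W ∧ (∀ x, W x ≠ 0) ∧ (∀ x, W x ∈ D x) ∧
  ∀ V, IsSection I (derivedDist I D) V → ∀ x, vfLie I W V x ∈ derivedDist I D x

/-- A Riemannian metric, given by its pointwise values. -/
structure RMetric (I : ModelWithCorners ℝ E H) (M : Type*) [TopologicalSpace M]
    [ChartedSpace H M] [IsManifold I (⊤ : ℕ∞) M] where
  val : ∀ x : M, TangentSpace I x →ₗ[ℝ] TangentSpace I x →ₗ[ℝ] ℝ
  symm : ∀ x u v, val x u v = val x v u
  posdef : ∀ x v, v ≠ 0 → 0 < val x v v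
  smooth' : ∀ V W, SmoothVF I V → SmoothVF I W → SmoothFn I (fun x => val x (V x) (W x))

/-- The Koszul formula: `koszul g X Y Z = g(∇_X Y, Z)` where `∇` is the Levi-Civita
connection of `g`. -/
def koszul (I : ModelWithCorners ℝ E H) {M : Type*} [TopologicalSpace M] [ChartedSpace H M]
    [IsManifold I (⊤ : ℕ∞) M] (g : RMetric I M) (X Y Z : VF I M) : M → ℝ := fun x =>
  (vderiv I X (fun y => g.val y (Y y) (Z y)) x + vderiv I Y (fun y => g.val y (X y) (Z y)) x
    - vderiv I Z (fun y => g.val y (X y) (Y y)) x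
    + g.val x (vfLie I X Y x) (Z x) - g.val x (vfLie I X Z x) (Y x)
    - g.val x (vfLie I Y Z x) (X x)) / 2

/-- A distribution `D` is totally geodesic for `g` iff every geodesic tangent to it at one
point stays tangent to it; equivalently (the standard characterization, which we take as the
definition) `∇_U U` is tangent to `D` for every section `U` of `D`, i.e. `g(∇_U U, V) = 0`
for every vector field `V` orthogonal to `D`. -/
def IsTotallyGeodesic (I : ModelWithCorners ℝ E H) {M : Type*} [TopologicalSpace M]
    [ChartedSpace H M] [IsManifold I (⊤ : ℕ∞) M] (g : RMetric I M)
    (D : TangentDist I M) : Prop :=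
  ∀ U, IsSection I D U → ∀ V, SmoothVF I V → (∀ x, ∀ u ∈ D x, g.val x (V x) u = 0) →
    ∀ x, koszul I g U U V x = 0

/-- A Killing vector field: `L_Z g = 0`, expressed on vector fields. -/
def IsKilling (I : ModelWithCorners ℝ E H) {M : Type*} [TopologicalSpace M] [ChartedSpace H M]
    [IsManifold I (⊤ : ℕ∞) M] (g : RMetric I M) (Z : VF I M) : Prop :=
  ∀ V W, SmoothVF I V → SmoothVF I W → ∀ x,
    vderiv I Z (fun y => g.val y (V y) (W y)) x
      = g.val x (vfLie I Z V x) (W x) + g.val x (V x) (vfLie I Z W x)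

/-- An Engel vector field: the flow of `Z` preserves `D`, i.e. `L_Z D ⊆ D`. -/
def IsEngelVF (I : ModelWithCorners ℝ E H) {M : Type*} [TopologicalSpace M] [ChartedSpace H M]
    [IsManifold I (⊤ : ℕ∞) M] (D : TangentDist I M) (Z : VF I M) : Prop :=
  SmoothVF I Z ∧ ∀ V, IsSection I D V → ∀ x, vfLie I Z V x ∈ D x

/-- A K-Engel structure: `D` is an Engel structure, `g` a Riemannian metric and `Z` a
(nowhere vanishing) vector field which is Engel, Killing and orthogonal to `E = [D,D]`. -/
structure IsKEngel (I : ModelWithCorners ℝ E H) {M : Type*} [TopologicalSpace M]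
    [ChartedSpace H M] [IsManifold I (⊤ : ℕ∞) M] (D : TangentDist I M)
    (g : RMetric I M) (Z : VF I M) : Prop where
  engel : IsEngel I D
  engelVF : IsEngelVF I D Z
  killing : IsKilling I g Z
  orth : ∀ x, ∀ v ∈ derivedDist I D x, g.val x (Z x) v = 0
  nonzero : ∀ x, Z x ≠ 0

/-- A `1`-form is closed. -/
def OneForm.IsClosed {I : ModelWithCorners ℝ E H} {M : Type*} [TopologicalSpace M]
    [ChartedSpace H M] [IsManifold I (⊤ : ℕ∞) M] (ω : OneForm I M) : Prop :=
  ∀ V W, SmoothVF I V → SmoothVF I W → ∀ x, ω.d V W x = 0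

/-- The Lie derivative `(L_Z ω)(V) = Z (ω V) - ω [Z,V]` of a `1`-form along a vector
field, as a function of vector fields. -/
def lieOneForm (I : ModelWithCorners ℝ E H) {M : Type*} [TopologicalSpace M] [ChartedSpace H M]
    [IsManifold I (⊤ : ℕ∞) M] (ω : OneForm I M) (Z V : VF I M) : M → ℝ := fun x =>
  vderiv I Z (fun y => ω.val y (V y)) x - ω.val x (vfLie I Z V x)

/-- The exterior derivative of a pointwise-defined `(m+1)`-form evaluated on `m+2` vector
fields, via the global Koszul formula. -/
def extDerEval (I : ModelWithCorners ℝ E H) {M : Type*} [TopologicalSpace M] [ChartedSpace H M]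
    [IsManifold I (⊤ : ℕ∞) M] {m : ℕ} (ν : FormPt I M (m+1)) (V : Fin (m+2) → VF I M) :
    M → ℝ := fun x =>
  (∑ i : Fin (m+2), (-1 : ℝ)^(i : ℕ) *
    vderiv I (V i) (fun y => ν.val y (fun l => V (i.succAbove l) y)) x)
  + ∑ i : Fin (m+2), ∑ j : Fin (m+2), if h : (i : ℕ) < (j : ℕ) then
      (-1 : ℝ)^((i : ℕ)+(j : ℕ)) * ν.val x (Fin.cons (vfLie I (V i) (V j) x)
        (fun l => V (j.succAbove ((⟨(i : ℕ), by have := j.2; omega⟩ : Fin (m+1)).succAbove l)) x))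
    else 0

/-- A pointwise-defined form is closed. -/
def FormPt.IsClosedForm {I : ModelWithCorners ℝ E H} {M : Type*} [TopologicalSpace M]
    [ChartedSpace H M] [IsManifold I (⊤ : ℕ∞) M] {m : ℕ} (ν : FormPt I M (m+1)) : Prop :=
  ∀ V : Fin (m+2) → VF I M, (∀ i, SmoothVF I (V i)) → ∀ x, extDerEval I ν V x = 0

/-- `φ : ℝ → M → M` is the flow of the vector field `Z`. -/
def IsFlowOf (I : ModelWithCorners ℝ E H) {M : Type*} [TopologicalSpace M] [ChartedSpace H M]
    [IsManifold I (⊤ : ℕ∞) M] (Z : VF I M) (φ : ℝ → M → M) : Prop :=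
  Continuous (fun p : ℝ × M => φ p.1 p.2) ∧ (∀ x, φ 0 x = x) ∧
  (∀ s t x, φ (s + t) x = φ s (φ t x)) ∧
  ∀ x t, HasMFDerivAt 𝓘(ℝ) I (fun s => φ s x) t
    ((1 : ℝ →L[ℝ] ℝ).smulRight (Z (φ t x)))

/-- `(η ∧ dη ∧ dη)(V₀,...,V₄)` up to a positive constant factor, for a pointwise `1`-form
`η`; pointwise nonvanishing of this expression on frames is the contact condition in
dimension 5. -/
def contactEval (I : ModelWithCorners ℝ E H) {M : Type*} [TopologicalSpace M] [ChartedSpace H M]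
    [IsManifold I (⊤ : ℕ∞) M] (η : ∀ z : M, TangentSpace I z →ₗ[ℝ] ℝ)
    (V : Fin 5 → VF I M) : M → ℝ := fun z =>
  ∑ σ : Equiv.Perm (Fin 5), ((Equiv.Perm.sign σ : ℤ) : ℝ) *
    (η z (V (σ 0) z) * dOfFun I (fun U x => η x (U x)) (V (σ 1)) (V (σ 2)) z *
      dOfFun I (fun U x => η x (U x)) (V (σ 3)) (V (σ 4)) z)

section Calculus

open VectorField Filter Topology

variable {V W U : VF I M} {f g : M → ℝ}

lemma smoothness_le_top (n : ℕ) : (n : WithTop ℕ∞) ≤ ((⊤ : ℕ∞) : WithTop ℕ∞) := by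
  exact_mod_cast (le_top : (n : ℕ∞) ≤ ⊤)

lemma vfLie_eq_mlieBracket [I.Boundaryless] (V W : VF I M) : vfLie I V W = mlieBracket I V W := by
  have : IsManifold I 1 M := IsManifold.of_le (n := (⊤ : ℕ∞)) (by simp)
  ext x
  have key : ∀ V : VF I M, (fun e => (mfderiv I 𝓘(ℝ, E) (extChartAt I x) ((extChartAt I x).symm e)
        (V ((extChartAt I x).symm e)) : E)) =ᶠ[𝓝 (extChartAt I x x)]
      (mpullbackWithin 𝓘(ℝ, E) I (extChartAt I x).symm V (range I)) := by
    intro V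
    filter_upwards [extChartAt_target_mem_nhds (I := I) x] with e he
    rw [mpullbackWithin_apply, ContinuousLinearMap.inverse_eq
      (mfderivWithin_extChartAt_symm_comp_mfderiv_extChartAt he)
      (mfderiv_extChartAt_comp_mfderivWithin_extChartAt_symm he)]
    rfl
  have hx := mem_extChartAt_source (I := I) x
  have hsymm := ContinuousLinearMap.inverse_eq
    (mfderiv_extChartAt_comp_mfderivWithin_extChartAt_symm' hx)
    (mfderivWithin_extChartAt_symm_comp_mfderiv_extChartAt' hx)
  rw [← mlieBracketWithin_univ, mlieBracketWithin_apply, hsymm, vfLie,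
    (key V).lieBracket_vectorField_eq (key W)]
  simp only [I.range_eq_univ, mfderivWithin_univ, preimage_univ, inter_univ]
  exact congrArg _ (congrFun lieBracketWithin_univ.symm _)

lemma SmoothVF.mdiff (hV : SmoothVF I V) (x : M) :
    MDifferentiableAt I I.tangent (fun x => (⟨x, V x⟩ : TangentBundle I M)) x :=
  hV.mdifferentiable (by simp) x

lemma SmoothFn.mdiff (hf : SmoothFn I f) (x : M) : MDifferentiableAt I 𝓘(ℝ) f x :=
  hf.mdifferentiable (by simp) x

lemma SmoothVF.smul (hf : SmoothFn I f) (hV : SmoothVF I V) :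
    SmoothVF I (fun x => f x • V x) :=
  ContMDiff.smul_section hf hV

lemma SmoothVF.vfLie [I.Boundaryless] [CompleteSpace E] (hV : SmoothVF I V) (hW : SmoothVF I W) :
    SmoothVF I (vfLie I V W) := by
  rw [vfLie_eq_mlieBracket]
  have : IsManifold I ((⊤ : ℕ∞) + 1) M := by simpa using ‹IsManifold I (⊤ : ℕ∞) M›
  have : IsManifold I (minSmoothness ℝ 2) M :=
    IsManifold.of_le (n := (⊤ : ℕ∞)) (by simpa using smoothness_le_top 2)
  intro x
  exact ContMDiffAt.mlieBracket_vectorField (n := ⊤) (m := ⊤) (hV x) (hW x) (by simp)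

lemma vfLie_swap [I.Boundaryless] (V W : VF I M) (x : M) : vfLie I V W x = - vfLie I W V x := by
  rw [vfLie_eq_mlieBracket, vfLie_eq_mlieBracket, mlieBracket_swap_apply]

lemma vfLie_jacobi [I.Boundaryless] [CompleteSpace E] (hU : SmoothVF I U) (hV : SmoothVF I V)
    (hW : SmoothVF I W) (x : M) :
    vfLie I U (vfLie I V W) x = vfLie I (vfLie I U V) W x + vfLie I V (vfLie I U W) x := by
  simp only [vfLie_eq_mlieBracket]
  have : IsManifold I (minSmoothness ℝ 3) M :=
    IsManifold.of_le (n := (⊤ : ℕ∞)) (by simpa using smoothness_le_top 3)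
  have h2 : minSmoothness ℝ 2 ≤ ((⊤ : ℕ∞) : WithTop ℕ∞) := by simpa using smoothness_le_top 2
  exact leibniz_identity_mlieBracket_apply ((hU x).of_le h2) ((hV x).of_le h2) ((hW x).of_le h2)

lemma vfLie_smul_right [I.Boundaryless] [CompleteSpace E] (V : VF I M) (hf : SmoothFn I f)
    (hW : SmoothVF I W) (x : M) :
    vfLie I V (fun y => f y • W y) x = vderiv I V f x • W x + f x • vfLie I V W x := by
  have : IsManifold I 1 M := IsManifold.of_le (n := (⊤ : ℕ∞)) (by simp)
  simp only [vfLie_eq_mlieBracket]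
  exact mlieBracket_smul_right (hf.mdiff x) (hW.mdiff x)

lemma vfLie_sum_right [I.Boundaryless] [CompleteSpace E] {ι : Type*} (s : Finset ι) (V : VF I M)
    {f : ι → M → ℝ} {e : ι → VF I M} (hf : ∀ i, SmoothFn I (f i)) (he : ∀ i, SmoothVF I (e i))
    (x : M) :
    vfLie I V (fun y => ∑ i ∈ s, f i y • e i y) x
      = ∑ i ∈ s, (vderiv I V (f i) x • e i x + f i x • vfLie I V (e i) x) := by
  classical
  have : IsManifold I 1 M := IsManifold.of_le (n := (⊤ : ℕ∞)) (by simp)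
  induction s using Finset.induction_on with
  | empty =>
    simp only [vfLie_eq_mlieBracket, Finset.sum_empty]
    exact congrFun (mlieBracket_zero_right (I := I) (W := V)) x
  | insert i s hi ih =>
    simp only [Finset.sum_insert hi]
    rw [← ih, ← vfLie_smul_right V (hf i) (he i)]
    simp only [vfLie_eq_mlieBracket]
    refine mlieBracket_add_right ((SmoothVF.smul (hf i) (he i)).mdiff x) ?_
    exact (ContMDiff.sum_section (s := s) fun i _ => SmoothVF.smul (hf i) (he i)).mdifferentiable
      (by simp) x

lemma vderiv_const (V : VF I M) (c : ℝ) (x : M) : vderiv I V (fun _ => c) x = 0 := by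
  exact congrArg (fun L => L (V x)) (mvfderiv_const (I := I) c (x := x))

lemma vderiv_mul (V : VF I M) (hf : SmoothFn I f) (hg : SmoothFn I g) (x : M) :
    vderiv I V (fun y => f y * g y) x = vderiv I V f x * g x + f x * vderiv I V g x := by
  refine (congrArg (fun L => L (V x)) (mvfderiv_fun_mul (hf.mdiff x) (hg.mdiff x))).trans ?_
  change f x * mvfderiv I g x (V x) + g x * mvfderiv I f x (V x)
    = mvfderiv I f x (V x) * g x + f x * mvfderiv I g x (V x)
  ring

lemma vderiv_sum {ι : Type*} (s : Finset ι) (V : VF I M)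
    {f : ι → M → ℝ} (hf : ∀ i, SmoothFn I (f i)) (x : M) :
    vderiv I V (fun y => ∑ i ∈ s, f i y) x = ∑ i ∈ s, vderiv I V (f i) x := by
  classical
  induction s using Finset.induction_on with
  | empty => simpa using vderiv_const V 0 x
  | insert i s hi ih =>
    simp only [Finset.sum_insert hi]
    rw [← ih]
    exact congrArg (fun L => L (V x)) (mvfderiv_fun_add ((hf i).mdiff x)
      ((contMDiff_finsetSum (t := s) fun i _ => hf i).mdifferentiable (by simp) x))

end Calculus

section Frame

variable {ι : Type*} [Fintype ι] {b : ∀ x : M, Basis ι ℝ (TangentSpace I x)} {V W : VF I M}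

lemma smoothFn_repr (hb : ∀ i, SmoothVF I (fun x => b x i)) (hV : SmoothVF I V) (i : ι) :
    SmoothFn I (fun x => (b x).repr (V x) i) := by
  intro x₀
  let e := trivializationAt E (TangentSpace I : M → Type _) x₀
  have hx₀ : x₀ ∈ e.baseSet := FiberBundle.mem_baseSet_trivializationAt' x₀
  let L : M → ((ι → ℝ) →L[ℝ] E) := fun y =>
    ∑ j, (ContinuousLinearMap.proj (R := ℝ) (φ := fun _ : ι => ℝ) j).smulRight (e ⟨y, b y j⟩).2
  have hL : ∀ y (hy : y ∈ e.baseSet), ∃ A : (ι → ℝ) ≃L[ℝ] E, (A : (ι → ℝ) →L[ℝ] E) = L y ∧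
      ∀ v : TangentSpace I y, A.symm (e ⟨y, v⟩).2 = (b y).equivFun v := by
    intro y hy
    let A := ((b y).equivFun.symm.trans (e.linearEquivAt ℝ y hy)).toContinuousLinearEquiv
    have hA : ∀ c, A c = e.linearEquivAt ℝ y hy ((b y).equivFun.symm c) := fun c => rfl
    refine ⟨A, ?_, fun v => ?_⟩
    · ext c
      simp only [ContinuousLinearEquiv.coe_coe, hA, L, _root_.sum_apply,
        Basis.equivFun_symm_apply, map_sum, map_smul]
      rfl
    · rw [ContinuousLinearEquiv.symm_apply_eq, hA]
      simp
  have hLs : ContMDiffAt I 𝓘(ℝ, (ι → ℝ) →L[ℝ] E) (⊤ : ℕ∞) L x₀ := by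
    refine contMDiffAt_finsetSum fun j _ => ?_
    have h1 := (e.contMDiffAt_section_iff hx₀).1 (hb j x₀)
    exact ((ContinuousLinearMap.smulRightL ℝ (ι → ℝ) E
      (ContinuousLinearMap.proj (R := ℝ) (φ := fun _ : ι => ℝ) j)).contDiff.contMDiff
        |>.contMDiffAt).comp x₀ h1
  obtain ⟨A, hA, -⟩ := hL x₀ hx₀
  have hinv : ContMDiffAt I 𝓘(ℝ, E →L[ℝ] (ι → ℝ)) (⊤ : ℕ∞)
      (fun y => ContinuousLinearMap.inverse (L y)) x₀ := by
    have h2 := contDiffAt_map_inverse (n := (⊤ : ℕ∞)) A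
    rw [hA] at h2
    exact h2.contMDiffAt.comp x₀ hLs
  have hVs := (e.contMDiffAt_section_iff hx₀).1 (hV x₀)
  have h3 : ContMDiffAt I 𝓘(ℝ) (⊤ : ℕ∞)
      (fun y => ContinuousLinearMap.inverse (L y) (e ⟨y, V y⟩).2 i) x₀ :=
    (contMDiffAt_pi_space.1 (hinv.clm_apply hVs)) i
  refine h3.congr_of_eventuallyEq ?_
  filter_upwards [e.open_baseSet.mem_nhds hx₀] with y hy
  obtain ⟨A, hA, hA'⟩ := hL y hy
  rw [← hA, ContinuousLinearMap.inverse_equiv, ContinuousLinearEquiv.coe_coe, hA',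
    Basis.equivFun_apply]

lemma vfLie_frame [I.Boundaryless] [CompleteSpace E] (hb : ∀ i, SmoothVF I (fun x => b x i))
    (hW : SmoothVF I W) (V : VF I M) (x : M) :
    vfLie I V W x = ∑ i, (vderiv I V (fun y => (b y).repr (W y) i) x • b x i
      + (b x).repr (W x) i • vfLie I V (fun y => b y i) x) := by
  rw [← vfLie_sum_right Finset.univ V (fun i => smoothFn_repr hb hW i) hb x]
  congr 1
  ext y
  exact ((b y).sum_repr (W y)).symm

lemma OneForm.d_swap [I.Boundaryless] (ω : OneForm I M) (V W : VF I M) (x : M) :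
    ω.d V W x = - ω.d W V x := by
  simp only [OneForm.d, dOfFun, vfLie_swap V W x, map_neg]
  ring

lemma OneForm.d_frame_right [I.Boundaryless] [CompleteSpace E]
    (hb : ∀ i, SmoothVF I (fun x => b x i)) (ω : OneForm I M)
    (hW : SmoothVF I W) (V : VF I M) (x : M) :
    ω.d V W x = ∑ i, (b x).repr (W x) i * ω.d V (fun y => b y i) x := by
  have hc := fun i => smoothFn_repr hb hW i
  have h1 : (fun y => ω.val y (W y)) = fun y => ∑ i, (b y).repr (W y) i * ω.val y (b y i) := by
    ext y
    conv_lhs => rw [← (b y).sum_repr (W y)]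
    rw [map_sum]
    simp only [map_smul, smul_eq_mul]
  have h2 : vderiv I W (fun y => ω.val y (V y)) x
      = ∑ i, (b x).repr (W x) i * vderiv I (fun y => b y i) (fun y => ω.val y (V y)) x := by
    unfold vderiv
    conv_lhs => rw [← (b x).sum_repr (W x)]
    rw [map_sum]
    exact Finset.sum_congr rfl fun i _ => map_smul _ _ _
  simp only [OneForm.d, dOfFun]
  rw [h1, h2, vfLie_frame hb hW V x,
    vderiv_sum Finset.univ V (f := fun i y => (b y).repr (W y) i * ω.val y (b y i))
      (fun i => (hc i).mul (ω.smooth' _ (hb i))), map_sum, ← Finset.sum_sub_distrib,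
    ← Finset.sum_sub_distrib]
  refine Finset.sum_congr rfl fun i _ => ?_
  rw [vderiv_mul V (hc i) (ω.smooth' _ (hb i)), map_add, map_smul, map_smul]
  simp only [smul_eq_mul]
  ring

lemma OneForm.d_right_of_eq_smul [I.Boundaryless] [CompleteSpace E]
    (hb : ∀ i, SmoothVF I (fun x => b x i)) (ω : OneForm I M) {V V' : VF I M}
    (hV : SmoothVF I V) (hV' : SmoothVF I V') (U : VF I M) {x : M} {c : ℝ}
    (h : V x = c • V' x) : ω.d U V x = c * ω.d U V' x := by
  rw [ω.d_frame_right hb hV U x, ω.d_frame_right hb hV' U x, h, Finset.mul_sum]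
  refine Finset.sum_congr rfl fun i _ => ?_
  rw [map_smul, Finsupp.smul_apply, smul_eq_mul, mul_assoc]

/-- The metric for which a smooth global frame is orthonormal. -/
def frameMetric (hb : ∀ i, SmoothVF I (fun x => b x i)) : RMetric I M where
  val x := ∑ i, ((b x).coord i).smulRight ((b x).coord i)
  symm x u v := by simp [mul_comm]
  posdef x v hv := by
    have hne : ∃ i, (b x).repr v i ≠ 0 := by
      by_contra! h
      exact hv ((b x).ext_elem fun i => by simpa using h i)
    obtain ⟨i, hi⟩ := hne
    simp only [LinearMap.sum_apply, LinearMap.smulRight_apply, LinearMap.smul_apply,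
      Basis.coord_apply, smul_eq_mul]
    exact Finset.sum_pos' (fun j _ => mul_self_nonneg _)
      ⟨i, Finset.mem_univ i, mul_self_pos.2 hi⟩
  smooth' V W hV hW := by
    simp only [LinearMap.sum_apply, LinearMap.smulRight_apply, LinearMap.smul_apply,
      Basis.coord_apply, smul_eq_mul]
    exact contMDiff_finsetSum fun i _ => (smoothFn_repr hb hV i).mul (smoothFn_repr hb hW i)

lemma frameMetric_val (hb : ∀ i, SmoothVF I (fun x => b x i)) (x : M) (u v : TangentSpace I x) :
    (frameMetric hb).val x u v = ∑ i, (b x).repr u i * (b x).repr v i := by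
  simp [frameMetric]

lemma isKilling_frameMetric [I.Boundaryless] [CompleteSpace E]
    (hb : ∀ i, SmoothVF I (fun x => b x i)) {Z : VF I M}
    (hZ : ∀ i x, vfLie I Z (fun y => b y i) x = 0) : IsKilling I (frameMetric hb) Z := by
  have hrepr : ∀ V, SmoothVF I V → ∀ x i,
      (b x).repr (vfLie I Z V x) i = vderiv I Z (fun y => (b y).repr (V y) i) x := by
    intro V hV x i
    rw [vfLie_frame hb hV Z x]
    simp only [hZ, smul_zero, add_zero]
    rw [(b x).repr_sum_self]
  intro V W hV hW x
  simp only [frameMetric_val, hrepr V hV, hrepr W hW]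
  rw [vderiv_sum Finset.univ Z (f := fun i y => (b y).repr (V y) i * (b y).repr (W y) i)
    (fun i => (smoothFn_repr hb hV i).mul (smoothFn_repr hb hW i)), ← Finset.sum_add_distrib]
  exact Finset.sum_congr rfl fun i _ =>
    vderiv_mul Z (smoothFn_repr hb hV i) (smoothFn_repr hb hW i) x

end Frame

section LieInvariance

variable {ω : OneForm I M} {R V W : VF I M}

lemma OneForm.d_eq_neg_of_const (ω : OneForm I M) {c c' : ℝ} (hV : ∀ x, ω.val x (V x) = c)
    (hW : ∀ x, ω.val x (W x) = c') (x : M) : ω.d V W x = - ω.val x (vfLie I V W x) := by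
  simp only [OneForm.d, dOfFun, hV, hW, vderiv_const]
  ring

lemma OneForm.d_self [I.Boundaryless] (ω : OneForm I M) (V : VF I M) (x : M) : ω.d V V x = 0 := by
  have := ω.d_swap V V x
  linarith

/-- If `i_R dω = 0` and `ω(R)`, `ω(V)` are constant, then `ω([R, V]) = 0`. -/
lemma OneForm.val_vfLie_eq_zero (hω : ∀ V, SmoothVF I V → ∀ x, ω.d R V x = 0) {r c : ℝ}
    (hR : ∀ x, ω.val x (R x) = r) (hVs : SmoothVF I V) (hV : ∀ x, ω.val x (V x) = c) (x : M) :
    ω.val x (vfLie I R V x) = 0 := by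
  have h := ω.d_eq_neg_of_const hR hV x
  rw [hω V hVs x] at h
  linarith

variable [I.Boundaryless] [CompleteSpace E]

/-- If `i_R dω = 0`, the Lie derivative of `dω` along `R` vanishes; here evaluated on vector
fields for which `ω` and `dω` are constant. -/
lemma OneForm.lie_d_eq_zero (hω : ∀ V, SmoothVF I V → ∀ x, ω.d R V x = 0) {r c c' k : ℝ}
    (hRs : SmoothVF I R) (hVs : SmoothVF I V) (hWs : SmoothVF I W)
    (hR : ∀ x, ω.val x (R x) = r) (hV : ∀ x, ω.val x (V x) = c)
    (hW : ∀ x, ω.val x (W x) = c') (hVW : ∀ x, ω.d V W x = k) (x : M) :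
    ω.d (vfLie I R V) W x + ω.d V (vfLie I R W) x = 0 := by
  have hbr : ∀ x, ω.val x (vfLie I V W x) = -k := fun x => by
    rw [← hVW x, ω.d_eq_neg_of_const hV hW x, neg_neg]
  have h := OneForm.val_vfLie_eq_zero hω hR (hVs.vfLie hWs) hbr x
  rw [vfLie_jacobi hRs hVs hWs x, map_add] at h
  rw [ω.d_eq_neg_of_const (OneForm.val_vfLie_eq_zero hω hR hVs hV) hW x,
    ω.d_eq_neg_of_const hV (OneForm.val_vfLie_eq_zero hω hR hWs hW) x]
  linarith

end LieInvariance

/-- A smooth global frame `(W, X, T, R)` for which `α` and `β` are the last elements of the dual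
coframe. -/
structure IsAdaptedFrame {M : Type*} [TopologicalSpace M]
    [ChartedSpace (EuclideanSpace ℝ (Fin 4)) M] [IsManifold (𝓡 4) (⊤ : ℕ∞) M]
    (α β : OneForm (𝓡 4) M) (W X T R : VF (𝓡 4) M) : Prop where
  smoothW : SmoothVF (𝓡 4) W
  smoothX : SmoothVF (𝓡 4) X
  smoothT : SmoothVF (𝓡 4) T
  smoothR : SmoothVF (𝓡 4) R
  alphaW : ∀ x, α.val x (W x) = 0
  alphaX : ∀ x, α.val x (X x) = 0
  alphaT : ∀ x, α.val x (T x) = 0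
  alphaR : ∀ x, α.val x (R x) = 1
  betaW : ∀ x, β.val x (W x) = 0
  betaX : ∀ x, β.val x (X x) = 0
  betaT : ∀ x, β.val x (T x) = 1
  betaR : ∀ x, β.val x (R x) = 0
  indep : ∀ x (a b : ℝ), a • W x + b • X x = 0 → a = 0 ∧ b = 0

namespace IsAdaptedFrame

variable {M : Type*} [TopologicalSpace M] [ChartedSpace (EuclideanSpace ℝ (Fin 4)) M]
  [IsManifold (𝓡 4) (⊤ : ℕ∞) M] {α β : OneForm (𝓡 4) M} {W X T R V U : VF (𝓡 4) M}

lemma exists_basis (h : IsAdaptedFrame α β W X T R) :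
    ∃ b : ∀ x : M, Basis (Fin 4) ℝ (TangentSpace (𝓡 4) x),
      ∀ i, (fun x => b x i) = (![W, X, T, R] : Fin 4 → VF (𝓡 4) M) i := by
  have hli : ∀ x, LinearIndependent ℝ
      (fun i => (![W, X, T, R] : Fin 4 → VF (𝓡 4) M) i x) := by
    intro x
    rw [Fintype.linearIndependent_iff]
    intro c hc
    simp only [Fin.sum_univ_four, Matrix.cons_val] at hc
    have hα := congrArg (α.val x) hc
    have hβ := congrArg (β.val x) hc
    simp only [map_add, map_smul, map_zero, h.alphaW, h.alphaX, h.alphaT, h.alphaR,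
      h.betaW, h.betaX, h.betaT, h.betaR, smul_eq_mul, mul_zero, mul_one, zero_add,
      add_zero] at hα hβ
    rw [hα, hβ, zero_smul, zero_smul, add_zero, add_zero] at hc
    obtain ⟨h0, h1⟩ := h.indep x _ _ hc
    intro i
    fin_cases i <;> assumption
  have hcard : ∀ x : M, Fintype.card (Fin 4) = finrank ℝ (TangentSpace (𝓡 4) x) := by
    intro x
    change _ = finrank ℝ (EuclideanSpace ℝ (Fin 4))
    simp
  refine ⟨fun x => basisOfLinearIndependentOfCardEqFinrank (hli x) (hcard x), fun i => ?_⟩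
  ext x
  simp

lemma smooth_basis (h : IsAdaptedFrame α β W X T R)
    {b : ∀ x : M, Basis (Fin 4) ℝ (TangentSpace (𝓡 4) x)}
    (hb : ∀ i, (fun x => b x i) = (![W, X, T, R] : Fin 4 → VF (𝓡 4) M) i) (i : Fin 4) :
    SmoothVF (𝓡 4) (fun x => b x i) := by
  rw [hb i]
  fin_cases i
  exacts [h.smoothW, h.smoothX, h.smoothT, h.smoothR]

lemma d_right_of_eq_smul (h : IsAdaptedFrame α β W X T R) (ω : OneForm (𝓡 4) M)
    {V V' : VF (𝓡 4) M} (hV : SmoothVF (𝓡 4) V) (hV' : SmoothVF (𝓡 4) V') (U : VF (𝓡 4) M)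
    {x : M} {c : ℝ} (hc : V x = c • V' x) : ω.d U V x = c * ω.d U V' x := by
  obtain ⟨b, hb⟩ := h.exists_basis
  exact ω.d_right_of_eq_smul (h.smooth_basis hb) hV hV' U hc

lemma d_left_of_eq_smul (h : IsAdaptedFrame α β W X T R) (ω : OneForm (𝓡 4) M)
    {V V' : VF (𝓡 4) M} (hV : SmoothVF (𝓡 4) V) (hV' : SmoothVF (𝓡 4) V') (U : VF (𝓡 4) M)
    {x : M} {c : ℝ} (hc : V x = c • V' x) : ω.d V U x = c * ω.d V' U x := by
  rw [ω.d_swap, h.d_right_of_eq_smul ω hV hV' U hc, ω.d_swap V']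
  ring

lemma d_right_of_eq_zero (h : IsAdaptedFrame α β W X T R) (ω : OneForm (𝓡 4) M)
    {V : VF (𝓡 4) M} (hV : SmoothVF (𝓡 4) V) (U : VF (𝓡 4) M)
    {x : M} (hx : V x = 0) : ω.d U V x = 0 := by
  have := h.d_right_of_eq_smul ω hV hV U (x := x) (c := 0) (by rw [hx, smul_zero])
  rwa [zero_mul] at this

/-- Expansion of a vector field and of `dω` in an adapted frame. -/
lemma expand (h : IsAdaptedFrame α β W X T R) (hV : SmoothVF (𝓡 4) V) (x : M) :
    ∃ a b : ℝ, V x = a • W x + b • X x + β.val x (V x) • T x + α.val x (V x) • R x ∧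
      ∀ (ω : OneForm (𝓡 4) M) (U : VF (𝓡 4) M), ω.d U V x = a * ω.d U W x + b * ω.d U X x
        + β.val x (V x) * ω.d U T x + α.val x (V x) * ω.d U R x := by
  obtain ⟨b, hb⟩ := h.exists_basis
  have hsum := (b x).sum_repr (V x)
  have hb' := fun i => congrFun (hb i) x
  simp only [Fin.sum_univ_four, hb', Matrix.cons_val] at hsum
  have hα := congrArg (α.val x) hsum
  have hβ := congrArg (β.val x) hsum
  simp only [map_add, map_smul, h.alphaW, h.alphaX, h.alphaT, h.alphaR,
    h.betaW, h.betaX, h.betaT, h.betaR, smul_eq_mul, mul_zero, mul_one, zero_add,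
    add_zero] at hα hβ
  refine ⟨(b x).repr (V x) 0, (b x).repr (V x) 1, ?_, fun ω U => ?_⟩
  · rw [← hα, ← hβ, hsum]
  · rw [ω.d_frame_right (h.smooth_basis hb) hV U x, Fin.sum_univ_four, hα, hβ]
    simp only [hb, Matrix.cons_val]

/-- A normalised adapted frame whose element `X` spans an `R`-invariant line field commutes
with `R`. -/
lemma vfLie_eq_zero (h : IsAdaptedFrame α β W X T R)
    (hαR : ∀ V, SmoothVF (𝓡 4) V → ∀ x, α.d R V x = 0)
    (hβR : ∀ V, SmoothVF (𝓡 4) V → ∀ x, β.d R V x = 0)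
    (hβT : ∀ V, SmoothVF (𝓡 4) V → ∀ x, β.d T V x = 0)
    (hαW : ∀ V, SmoothVF (𝓡 4) V → ∀ x, α.d W V x = 0)
    (hαXT : ∀ x, α.d X T x = 1) (hβWX : ∀ x, β.d W X x = 1)
    (hinv : ∀ x, ∃ c : ℝ, vfLie (𝓡 4) R X x = c • X x) (x : M) :
    vfLie (𝓡 4) R W x = 0 ∧ vfLie (𝓡 4) R X x = 0 ∧ vfLie (𝓡 4) R T x = 0 := by
  have sRW := h.smoothR.vfLie h.smoothW
  have sRX := h.smoothR.vfLie h.smoothX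
  have sRT := h.smoothR.vfLie h.smoothT
  have hβXW : ∀ x, β.d X W x = -1 := fun x => by rw [β.d_swap, hβWX x]
  have hRT : ∀ x, vfLie (𝓡 4) R T x = 0 := by
    intro x
    obtain ⟨a, b, hv, hd⟩ := h.expand sRT x
    rw [OneForm.val_vfLie_eq_zero hαR h.alphaR h.smoothT h.alphaT x,
      OneForm.val_vfLie_eq_zero hβR h.betaR h.smoothT h.betaT x] at hv hd
    have h1 := OneForm.lie_d_eq_zero hβR h.smoothR h.smoothT h.smoothX h.betaR h.betaT h.betaX
      (hβT X h.smoothX) x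
    have h2 := OneForm.lie_d_eq_zero hβR h.smoothR h.smoothT h.smoothW h.betaR h.betaT h.betaW
      (hβT W h.smoothW) x
    rw [hβT _ sRX x, β.d_swap, hd, hβXW x, β.d_self] at h1
    rw [hβT _ sRW x, β.d_swap, hd, hβWX x, β.d_self] at h2
    have ha : a = 0 := by linarith
    have hb : b = 0 := by linarith
    rw [hv, ha, hb]
    simp
  have hRX : ∀ x, vfLie (𝓡 4) R X x = 0 := by
    intro x
    obtain ⟨c, hc⟩ := hinv x
    have h1 := OneForm.lie_d_eq_zero hαR h.smoothR h.smoothX h.smoothT h.alphaR h.alphaX h.alphaT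
      hαXT x
    rw [h.d_right_of_eq_zero α sRT X (hRT x), h.d_left_of_eq_smul α sRX h.smoothX T hc,
      hαXT x] at h1
    rw [hc, show c = 0 by linarith, zero_smul]
  refine ⟨?_, hRX x, hRT x⟩
  obtain ⟨a, b, hv, hd⟩ := h.expand sRW x
  rw [OneForm.val_vfLie_eq_zero hαR h.alphaR h.smoothW h.alphaW x,
    OneForm.val_vfLie_eq_zero hβR h.betaR h.smoothW h.betaW x] at hv hd
  have h1 := OneForm.lie_d_eq_zero hαR h.smoothR h.smoothW h.smoothT h.alphaR h.alphaW h.alphaT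
    (hαW T h.smoothT) x
  have h2 := OneForm.lie_d_eq_zero hβR h.smoothR h.smoothW h.smoothX h.betaR h.betaW h.betaX
    hβWX x
  rw [hαW _ sRT x, α.d_swap, hd, α.d_swap T W, hαW T h.smoothT x, α.d_swap T X, hαXT x] at h1
  rw [h.d_right_of_eq_zero β sRX W (hRX x), β.d_swap, hd, hβXW x, β.d_self] at h2
  have ha : a = 0 := by linarith
  have hb : b = 0 := by linarith
  rw [hv, ha, hb]
  simp

lemma d_right_eq_zero (h : IsAdaptedFrame α β W X T R) (ω : OneForm (𝓡 4) M) {x : M}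
    (hW : ω.d U W x = 0) (hX : ω.d U X x = 0) (hT : ω.d U T x = 0) (hR : ω.d U R x = 0)
    (hV : SmoothVF (𝓡 4) V) : ω.d U V x = 0 := by
  obtain ⟨a, b, -, hd⟩ := h.expand hV x
  rw [hd, hW, hX, hT, hR]
  ring

/-- `dω` vanishes on `ker α ∩ ker β` at a point where `dω(W, X)` does. -/
lemma d_eq_zero_of_ker (h : IsAdaptedFrame α β W X T R) (ω : OneForm (𝓡 4) M) {x : M}
    (hWX : ω.d W X x = 0) (hU : SmoothVF (𝓡 4) U) (hV : SmoothVF (𝓡 4) V)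
    (hαU : α.val x (U x) = 0) (hβU : β.val x (U x) = 0)
    (hαV : α.val x (V x) = 0) (hβV : β.val x (V x) = 0) : ω.d U V x = 0 := by
  obtain ⟨a, b, -, hd⟩ := h.expand hV x
  obtain ⟨a', b', -, hd'⟩ := h.expand hU x
  rw [hd, hαV, hβV, ω.d_swap U W, ω.d_swap U X, hd', hd', hαU, hβU, ω.d_self, ω.d_self,
    ω.d_swap X W, hWX]
  ring

/-- `dω` vanishes on `ker α` at a point where it vanishes on pairs of `W`, `X`, `T`. -/
lemma d_eq_zero_of_ker_left (h : IsAdaptedFrame α β W X T R) (ω : OneForm (𝓡 4) M) {x : M}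
    (hWX : ω.d W X x = 0) (hWT : ω.d W T x = 0) (hXT : ω.d X T x = 0)
    (hU : SmoothVF (𝓡 4) U) (hV : SmoothVF (𝓡 4) V)
    (hαU : α.val x (U x) = 0) (hαV : α.val x (V x) = 0) : ω.d U V x = 0 := by
  obtain ⟨a, b, -, hd⟩ := h.expand hV x
  obtain ⟨a', b', -, hd'⟩ := h.expand hU x
  rw [hd, hαV, ω.d_swap U W, ω.d_swap U X, ω.d_swap U T, hd', hd', hd', hαU, ω.d_self,
    ω.d_self, ω.d_self, ω.d_swap X W, ω.d_swap T W, ω.d_swap T X, hWX, hWT, hXT]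
  ring

/-- Rescaling `W` and `X` by nowhere vanishing functions gives an adapted frame. -/
lemma smul (h : IsAdaptedFrame α β W X T R) {p q : M → ℝ} (hp : SmoothFn (𝓡 4) p)
    (hq : SmoothFn (𝓡 4) q) (hp0 : ∀ x, p x ≠ 0) (hq0 : ∀ x, q x ≠ 0) :
    IsAdaptedFrame α β (fun x => p x • W x) (fun x => q x • X x) T R where
  smoothW := h.smoothW.smul hp
  smoothX := h.smoothX.smul hq
  smoothT := h.smoothT
  smoothR := h.smoothR
  alphaW x := by rw [map_smul, h.alphaW, smul_zero]
  alphaX x := by rw [map_smul, h.alphaX, smul_zero]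
  alphaT := h.alphaT
  alphaR := h.alphaR
  betaW x := by rw [map_smul, h.betaW, smul_zero]
  betaX x := by rw [map_smul, h.betaX, smul_zero]
  betaT := h.betaT
  betaR := h.betaR
  indep x a b hab := by
    rw [smul_smul, smul_smul] at hab
    simpa [hp0 x, hq0 x] using h.indep x _ _ hab

/-- The metric making an `R`-invariant adapted frame orthonormal is invariant under `R`, and `R`
is orthogonal to `ker α`. -/
lemma exists_metric (h : IsAdaptedFrame α β W X T R)
    (hRW : ∀ x, vfLie (𝓡 4) R W x = 0) (hRX : ∀ x, vfLie (𝓡 4) R X x = 0)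
    (hRT : ∀ x, vfLie (𝓡 4) R T x = 0) :
    ∃ g : RMetric (𝓡 4) M, IsKilling (𝓡 4) g R ∧
      ∀ x v, α.val x v = 0 → g.val x (R x) v = 0 := by
  obtain ⟨b, hb⟩ := h.exists_basis
  have hb' := fun i => congrFun (hb i)
  have hRR : ∀ x, vfLie (𝓡 4) R R x = 0 := fun x => by
    rw [vfLie_eq_mlieBracket, VectorField.mlieBracket_self, Pi.zero_apply]
  refine ⟨frameMetric (h.smooth_basis hb), isKilling_frameMetric _ fun i x => ?_,
    fun x v hv => ?_⟩
  · rw [hb i]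
    fin_cases i
    exacts [hRW x, hRX x, hRT x, hRR x]
  · have hR : R x = b x 3 := (hb' 3 x).symm
    have hα := congrArg (α.val x) ((b x).sum_repr v)
    simp only [Fin.sum_univ_four, hb', Matrix.cons_val, map_add, map_smul, h.alphaW, h.alphaX,
      h.alphaT, h.alphaR, smul_eq_mul, mul_zero, mul_one, zero_add, hv] at hα
    rw [frameMetric_val, hR, (b x).repr_self, Fin.sum_univ_four, hα]
    simp

/-- Suppose `R` annihilates `dα` and `dβ`, `T` annihilates `dβ` and `W` annihilates `dα`, while
`dα(X, T)` and `dβ(W, X)` vanish nowhere. If `R` preserves the line field spanned by `X`, then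
`R` is Killing for some metric for which it is orthogonal to `ker α`. -/
lemma exists_metric_of_invariant (h : IsAdaptedFrame α β W X T R)
    (hαR : ∀ V, SmoothVF (𝓡 4) V → ∀ x, α.d R V x = 0)
    (hβR : ∀ V, SmoothVF (𝓡 4) V → ∀ x, β.d R V x = 0)
    (hβT : ∀ V, SmoothVF (𝓡 4) V → ∀ x, β.d T V x = 0)
    (hαW : ∀ V, SmoothVF (𝓡 4) V → ∀ x, α.d W V x = 0)
    (hαXT : ∀ x, α.d X T x ≠ 0) (hβWX : ∀ x, β.d W X x ≠ 0)
    (hinv : ∀ x, ∃ c : ℝ, vfLie (𝓡 4) R X x = c • X x) :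
    ∃ g : RMetric (𝓡 4) M, IsKilling (𝓡 4) g R ∧
      ∀ x v, α.val x v = 0 → g.val x (R x) v = 0 := by
  have sk : SmoothFn (𝓡 4) (α.d X T) := by
    have : α.d X T = fun x => - α.val x (vfLie (𝓡 4) X T x) :=
      funext (α.d_eq_neg_of_const h.alphaX h.alphaT)
    rw [this]
    exact (α.smooth' _ (h.smoothX.vfLie h.smoothT)).neg
  have sh : SmoothFn (𝓡 4) (β.d W X) := by
    have : β.d W X = fun x => - β.val x (vfLie (𝓡 4) W X x) :=
      funext (β.d_eq_neg_of_const h.betaW h.betaX)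
    rw [this]
    exact (β.smooth' _ (h.smoothW.vfLie h.smoothX)).neg
  have hq : SmoothFn (𝓡 4) (fun x => (α.d X T x)⁻¹) := ContMDiff.inv₀ sk hαXT
  have hp : SmoothFn (𝓡 4) (fun x => α.d X T x * (β.d W X x)⁻¹) :=
    ContMDiff.mul sk (ContMDiff.inv₀ sh hβWX)
  have hn := h.smul hp hq (fun x => mul_ne_zero (hαXT x) (inv_ne_zero (hβWX x)))
    (fun x => inv_ne_zero (hαXT x))
  have hzero := hn.vfLie_eq_zero hαR hβR hβT
    (fun V hV x => by rw [h.d_left_of_eq_smul α hn.smoothW h.smoothW V rfl, hαW V hV x, mul_zero])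
    (fun x => by
      rw [h.d_left_of_eq_smul α hn.smoothX h.smoothX T rfl, inv_mul_cancel₀ (hαXT x)])
    (fun x => by
      rw [h.d_left_of_eq_smul β hn.smoothW h.smoothW _ rfl,
        h.d_right_of_eq_smul β hn.smoothX h.smoothX _ rfl]
      have := hαXT x
      have := hβWX x
      field_simp)
    (fun x => by
      obtain ⟨c, hc⟩ := hinv x
      refine ⟨vderiv (𝓡 4) R (fun x => (α.d X T x)⁻¹) x * α.d X T x + c, ?_⟩
      rw [vfLie_smul_right R hq h.smoothX x, hc, smul_smul, smul_smul, ← add_smul]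
      congr 1
      have := hαXT x
      field_simp)
  exact hn.exists_metric (fun x => (hzero x).1) (fun x => (hzero x).2.1) (fun x => (hzero x).2.2)

end IsAdaptedFrame

section EngelForms

variable {M : Type*} [TopologicalSpace M] [ChartedSpace (EuclideanSpace ℝ (Fin 4)) M]
  [IsManifold (𝓡 4) (⊤ : ℕ∞) M] {D : TangentDist (𝓡 4) M} {α β : OneForm (𝓡 4) M}
  {W X T R V U : VF (𝓡 4) M}

lemma EngelDefiningForms.mem_iff (hf : EngelDefiningForms (𝓡 4) D α β) {x : M}
    {v : TangentSpace (𝓡 4) x} : v ∈ D x ↔ α.val x v = 0 ∧ β.val x v = 0 := by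
  rw [hf.1 x, Submodule.mem_inf, LinearMap.mem_ker, LinearMap.mem_ker]

lemma EngelDefiningForms.mem_derivedDist_iff (hf : EngelDefiningForms (𝓡 4) D α β) {x : M}
    {v : TangentSpace (𝓡 4) x} : v ∈ derivedDist (𝓡 4) D x ↔ α.val x v = 0 := by
  rw [hf.2 x, LinearMap.mem_ker]

/-- `α` vanishes on brackets of sections of `D`. -/
lemma EngelDefiningForms.alpha_vfLie (hf : EngelDefiningForms (𝓡 4) D α β)
    (hU : IsSection (𝓡 4) D U) (hV : IsSection (𝓡 4) D V) (x : M) :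
    α.val x (vfLie (𝓡 4) U V x) = 0 :=
  hf.mem_derivedDist_iff.1 (Submodule.subset_span (Or.inr ⟨U, V, hU, hV, rfl⟩))

lemma EngelDefiningForms.isAdaptedFrame (hf : EngelDefiningForms (𝓡 4) D α β)
    (hTR : IsReebPair (𝓡 4) α β T R) (hW : SpansChar (𝓡 4) D W) (hXs : SmoothVF (𝓡 4) X)
    (hXD : ∀ x, X x ∈ D x) (hX : ∀ x, X x ∉ (ℝ ∙ (W x) : Submodule ℝ _)) :
    IsAdaptedFrame α β W X T R where
  smoothW := hW.1
  smoothX := hXs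
  smoothT := hTR.smoothT
  smoothR := hTR.smoothR
  alphaW x := (hf.mem_iff.1 (hW.2.2.1 x)).1
  alphaX x := (hf.mem_iff.1 (hXD x)).1
  alphaT := hTR.alphaT
  alphaR := hTR.alphaR
  betaW x := (hf.mem_iff.1 (hW.2.2.1 x)).2
  betaX x := (hf.mem_iff.1 (hXD x)).2
  betaT := hTR.betaT
  betaR := hTR.betaR
  indep x a b hab := by
    have hb : b = 0 := by
      by_contra hb
      refine hX x (Submodule.mem_span_singleton.2 ⟨-(b⁻¹ * a), ?_⟩)
      have h1 := congrArg (fun v => b⁻¹ • v) hab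
      simp only [smul_add, smul_smul, inv_mul_cancel₀ hb, one_smul, smul_zero] at h1
      rw [neg_smul]
      exact neg_eq_of_add_eq_zero_right h1
    rw [hb, zero_smul, add_zero] at hab
    exact ⟨(smul_eq_zero.1 hab).resolve_right (hW.2.1 x), hb⟩

/-- `dβ` does not vanish on `D`, since `[D, D]` has rank three. -/
lemma IsAdaptedFrame.d_beta_ne_zero (h : IsAdaptedFrame α β W X T R) (hD : IsEngel (𝓡 4) D)
    (hf : EngelDefiningForms (𝓡 4) D α β) (x : M) : β.d W X x ≠ 0 := by
  intro h0
  have hle : derivedDist (𝓡 4) D x ≤ D x := by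
    refine Submodule.span_le.2 (Set.union_subset ?_ ?_)
    · rintro v ⟨V, hV, rfl⟩
      exact hV.2 x
    · rintro v ⟨U, V, hU, hV, rfl⟩
      have hU' := fun x => hf.mem_iff.1 (hU.2 x)
      have hV' := fun x => hf.mem_iff.1 (hV.2 x)
      refine hf.mem_iff.2 ⟨hf.alpha_vfLie hU hV x, ?_⟩
      have h1 := h.d_eq_zero_of_ker β h0 hU.1 hV.1 (hU' x).1 (hU' x).2 (hV' x).1 (hV' x).2
      rwa [β.d_eq_neg_of_const (fun x => (hU' x).2) (fun x => (hV' x).2), neg_eq_zero] at h1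
  have : FiniteDimensional ℝ (TangentSpace (𝓡 4) x) :=
    inferInstanceAs (FiniteDimensional ℝ (EuclideanSpace ℝ (Fin 4)))
  have := Submodule.finrank_mono hle
  rw [hD.1 x, hD.2.1 x] at this
  omega

/-- `dα` does not vanish on `ker α`, since `[ker α, ker α] = TM`. -/
lemma IsAdaptedFrame.d_alpha_ne_zero (h : IsAdaptedFrame α β W X T R) (hD : IsEngel (𝓡 4) D)
    (hf : EngelDefiningForms (𝓡 4) D α β)
    (hαW : ∀ V, SmoothVF (𝓡 4) V → ∀ x, α.d W V x = 0) (x : M) : α.d X T x ≠ 0 := by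
  intro h0
  have hle : derivedDist (𝓡 4) (derivedDist (𝓡 4) D) x ≤ LinearMap.ker (α.val x) := by
    refine Submodule.span_le.2 (Set.union_subset ?_ ?_)
    · rintro v ⟨V, hV, rfl⟩
      exact hf.mem_derivedDist_iff.1 (hV.2 x)
    · rintro v ⟨U, V, hU, hV, rfl⟩
      have hU' := fun x => hf.mem_derivedDist_iff.1 (hU.2 x)
      have hV' := fun x => hf.mem_derivedDist_iff.1 (hV.2 x)
      have h1 := h.d_eq_zero_of_ker_left α (hαW X h.smoothX x) (hαW T h.smoothT x) h0 hU.1 hV.1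
        (hU' x) (hV' x)
      rwa [α.d_eq_neg_of_const hU' hV', neg_eq_zero] at h1
  rw [hD.2.2 x] at hle
  have h1 : α.val x (R x) = 0 := hle Submodule.mem_top
  rw [h.alphaR x] at h1
  exact one_ne_zero h1

/-- `dβ ∧ dβ = 0` forces both Reeb fields to annihilate `dβ`. -/
lemma IsAdaptedFrame.d_beta_reeb (h : IsAdaptedFrame α β W X T R)
    (hTR : IsReebPair (𝓡 4) α β T R) (hβ2 : FormSqZero (𝓡 4) β.d)
    (hβWX : ∀ x, β.d W X x ≠ 0) (hV : SmoothVF (𝓡 4) V) (x : M) :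
    β.d R V x = 0 ∧ β.d T V x = 0 := by
  have hR : ∀ V, SmoothVF (𝓡 4) V → β.d R V x = β.val x (V x) * β.d R T x := fun V hV => by
    have := hTR.insR T V hTR.smoothT hV x
    rw [wedge1_2, h.betaR, h.betaT] at this
    linarith
  have hT : ∀ V, SmoothVF (𝓡 4) V → β.d T V x = α.val x (V x) * β.d T R x := fun V hV => by
    have := hTR.insT R V hTR.smoothR hV x
    rw [wedge1_2, h.alphaR, h.alphaT] at this
    linarith
  have hTR0 : β.d T R x = 0 := by
    have := hβ2 W X T R h.smoothW h.smoothX h.smoothT h.smoothR x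
    rw [β.d_swap X R, β.d_swap W R, hR X h.smoothX, hR W h.smoothW, h.betaX, h.betaW] at this
    simpa [hβWX x] using this
  rw [hR V hV, hT V hV, β.d_swap R T, hTR0]
  simp

/-- `dα ∧ β = 0` forces the Reeb field `R` to annihilate `dα`, up to a multiple of `β`. -/
lemma IsAdaptedFrame.d_alpha_reeb_eq (h : IsAdaptedFrame α β W X T R)
    (hαβ : ∀ U V W, SmoothVF (𝓡 4) U → SmoothVF (𝓡 4) V → SmoothVF (𝓡 4) W → ∀ x,
      wedge1_2 (𝓡 4) β α.d U V W x = 0) (hV : SmoothVF (𝓡 4) V) (x : M) :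
    α.d R V x = β.val x (V x) * α.d R T x := by
  have := hαβ T R V h.smoothT h.smoothR hV x
  rw [wedge1_2, h.betaT, h.betaR, α.d_swap T R] at this
  linarith

/-- The characteristic foliation annihilates `dα`. -/
lemma IsAdaptedFrame.d_alpha_char (h : IsAdaptedFrame α β W X T R)
    (hf : EngelDefiningForms (𝓡 4) D α β) (hW : SpansChar (𝓡 4) D W)
    (hαRW : ∀ x, α.d R W x = 0) (hV : SmoothVF (𝓡 4) V) (x : M) : α.d W V x = 0 := by
  have key : ∀ V, SmoothVF (𝓡 4) V → (∀ x, α.val x (V x) = 0) → α.d W V x = 0 := fun V hV hα => by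
    rw [α.d_eq_neg_of_const h.alphaW hα, neg_eq_zero]
    exact hf.mem_derivedDist_iff.1
      (hW.2.2.2 V ⟨hV, fun x => hf.mem_derivedDist_iff.2 (hα x)⟩ x)
  exact h.d_right_eq_zero α (α.d_self W x) (key X h.smoothX h.alphaX) (key T h.smoothT h.alphaT)
    (by rw [α.d_swap, hαRW x, neg_zero]) hV

/-- If `R` preserves `D`, then it annihilates `dα`. -/
lemma IsAdaptedFrame.d_alpha_reeb (h : IsAdaptedFrame α β W X T R)
    (hf : EngelDefiningForms (𝓡 4) D α β)
    (hαR : ∀ V, SmoothVF (𝓡 4) V → ∀ x, α.d R V x = β.val x (V x) * α.d R T x)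
    (hβR : ∀ V, SmoothVF (𝓡 4) V → ∀ x, β.d R V x = 0)
    (hβWX : ∀ x, β.d W X x ≠ 0) (hV : SmoothVF (𝓡 4) V) (x : M) : α.d R V x = 0 := by
  have hsec : ∀ {V}, IsSection (𝓡 4) D V → IsSection (𝓡 4) D (vfLie (𝓡 4) R V) := fun {V} hV => by
    have hV' := fun x => hf.mem_iff.1 (hV.2 x)
    refine ⟨h.smoothR.vfLie hV.1, fun x => hf.mem_iff.2 ⟨?_, ?_⟩⟩
    · have h1 := hαR V hV.1 x
      rwa [(hV' x).2, zero_mul, α.d_eq_neg_of_const h.alphaR (fun x => (hV' x).1),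
        neg_eq_zero] at h1
    · exact OneForm.val_vfLie_eq_zero hβR h.betaR hV.1 (fun x => (hV' x).2) x
  have hW : IsSection (𝓡 4) D W := ⟨h.smoothW, fun x => hf.mem_iff.2 ⟨h.alphaW x, h.betaW x⟩⟩
  have hX : IsSection (𝓡 4) D X := ⟨h.smoothX, fun x => hf.mem_iff.2 ⟨h.alphaX x, h.betaX x⟩⟩
  have h1 := hαR _ (h.smoothW.vfLie h.smoothX) x
  rw [α.d_eq_neg_of_const h.alphaR (hf.alpha_vfLie hW hX),
    vfLie_jacobi h.smoothR h.smoothW h.smoothX, map_add, hf.alpha_vfLie (hsec hW) hX,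
    hf.alpha_vfLie hW (hsec hX)] at h1
  have h2 : β.val x (vfLie (𝓡 4) W X x) ≠ 0 := fun h0 => hβWX x (by
    rw [β.d_eq_neg_of_const h.betaW h.betaX, h0, neg_zero])
  have h3 : α.d R T x = 0 := by simpa [h2] using h1
  rw [hαR V hV, h3, mul_zero]

end EngelForms

/-- Let `D = ker α∧β` be an Engel structure with `dα ∧ dα = 0`,
`dβ ∧ dβ = 0` and `dα ∧ β = 0`.  If there is a section `X` of `D` transverse to the
characteristic foliation with `L_R ⟨X⟩ = ⟨X⟩`, then there exists a Riemannian metric `g`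
such that `(D, g, R)` is a K-Engel structure. -/
theorem good_forms_and_diagonal_action_give_kengel {M : Type*} [TopologicalSpace M]
    [ChartedSpace (EuclideanSpace ℝ (Fin 4)) M] [IsManifold (𝓡 4) (⊤ : ℕ∞) M]
    (D : TangentDist (𝓡 4) M) (α β : OneForm (𝓡 4) M)
    (hD : IsEngel (𝓡 4) D) (hforms : EngelDefiningForms (𝓡 4) D α β)
    (hα2 : FormSqZero (𝓡 4) α.d) (hβ2 : FormSqZero (𝓡 4) β.d)
    (hαβ : ∀ U V W, SmoothVF (𝓡 4) U → SmoothVF (𝓡 4) V → SmoothVF (𝓡 4) W → ∀ x,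
      wedge1_2 (𝓡 4) β α.d U V W x = 0)
    (T R : VF (𝓡 4) M) (hTR : IsReebPair (𝓡 4) α β T R)
    (W₀ : VF (𝓡 4) M) (hW₀ : SpansChar (𝓡 4) D W₀)
    (X : VF (𝓡 4) M) (hXs : SmoothVF (𝓡 4) X) (hXD : ∀ x, X x ∈ D x)
    (hXtrans : ∀ x, X x ∉ (ℝ ∙ (W₀ x) : Submodule ℝ _))
    -- `L_R ⟨X⟩ = ⟨X⟩`
    (hinv : ∀ x, vfLie (𝓡 4) R X x ∈ (ℝ ∙ (X x) : Submodule ℝ _)) :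
    ∃ g : RMetric (𝓡 4) M, IsKEngel (𝓡 4) D g R := by
  have h := hforms.isAdaptedFrame hTR hW₀ hXs hXD hXtrans
  have hβWX := h.d_beta_ne_zero hD hforms
  have hβR : ∀ V, SmoothVF (𝓡 4) V → ∀ x, β.d R V x = 0 := fun V hV x =>
    (h.d_beta_reeb hTR hβ2 hβWX hV x).1
  have hβT : ∀ V, SmoothVF (𝓡 4) V → ∀ x, β.d T V x = 0 := fun V hV x =>
    (h.d_beta_reeb hTR hβ2 hβWX hV x).2
  have hαR : ∀ V, SmoothVF (𝓡 4) V → ∀ x, α.d R V x = 0 := fun V hV x =>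
    h.d_alpha_reeb hforms (fun V hV x => h.d_alpha_reeb_eq hαβ hV x) hβR hβWX hV x
  have hαW : ∀ V, SmoothVF (𝓡 4) V → ∀ x, α.d W₀ V x = 0 := fun V hV x =>
    h.d_alpha_char hforms hW₀ (hαR W₀ h.smoothW) hV x
  obtain ⟨g, hkill, horth⟩ := h.exists_metric_of_invariant hαR hβR hβT hαW
    (h.d_alpha_ne_zero hD hforms hαW) hβWX fun x => by
      obtain ⟨c, hc⟩ := Submodule.mem_span_singleton.1 (hinv x)
      exact ⟨c, hc.symm⟩
  refine ⟨g, hD, ⟨h.smoothR, fun V hV x => ?_⟩, hkill,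
    fun x v hv => horth x v (hforms.mem_derivedDist_iff.1 hv), fun x hx => ?_⟩
  · have hV' := fun x => hforms.mem_iff.1 (hV.2 x)
    exact hforms.mem_iff.2
      ⟨OneForm.val_vfLie_eq_zero hαR h.alphaR hV.1 (fun x => (hV' x).1) x,
        OneForm.val_vfLie_eq_zero hβR h.betaR hV.1 (fun x => (hV' x).2) x⟩
  · have h1 := h.alphaR x
    rw [hx, map_zero] at h1
    exact zero_ne_one h1

end
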